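/- arXiv:2411.02474 — 3 statements merged into one kernel-verified Lean document; each statement's English description precedes it below -/
import Mathlib

section
/- Let G and H be groups. Suppose G admits an invariant mean, and suppose there exist constants c ≥ 1 and ε₀ > 0 such that for every complex Hilbert space ℋ and every map f : H → U(ℋ) with f(1) = 1 and δ(f) ≤ ε for some ε ≤ ε₀, there exists a group homomorphism ρ : H → U(ℋ) with sup_{x∈H} ‖f(x) − ρ(x)‖ ≤ c·ε. Then there exist constants C > 0 and ε₁ > 0 such that for every complex Hilbert space ℋ and every map f : G×H → U(ℋ) with f(1,1) = 1 and δ(f) ≤ ε for some ε ≤ ε₁, there exists a group homomorphism ρ : G×H → U(ℋ) with sup_{(x,y)∈G×H} ‖f(x,y) − ρ(x,y)‖ ≤ C·ε. In particular, G×H is strongly Ulam stable with modulus O(ε). -/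
/-- A real-valued function is bounded. -/
def IsBddR {X : Type*} (φ : X → ℝ) : Prop := ∃ C, ∀ x, |φ x| ≤ C

/-- A mean on a set `X`: a positive normalized linear functional on the
bounded real-valued functions on `X`. -/
structure Mean (X : Type*) where
  app : (X → ℝ) → ℝ
  app_add : ∀ φ ψ : X → ℝ, IsBddR φ → IsBddR ψ →
    app (fun x => φ x + ψ x) = app φ + app ψ
  app_smul : ∀ (r : ℝ) (φ : X → ℝ), IsBddR φ →
    app (fun x => r * φ x) = r * app φ
  app_nonneg : ∀ φ : X → ℝ, IsBddR φ → (∀ x, 0 ≤ φ x) → 0 ≤ app φ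
  app_one : app (fun _ => 1) = 1

/-- An invariant mean on a group `G`: a mean invariant under left and right
translations. A group admitting an invariant mean is amenable. -/
structure InvariantMean (G : Type*) [Group G] extends Mean G where
  app_left : ∀ (g : G) (φ : G → ℝ), IsBddR φ → app (fun x => φ (g * x)) = app φ
  app_right : ∀ (g : G) (φ : G → ℝ), IsBddR φ → app (fun x => φ (x * g)) = app φ

universe u

open scoped InnerProductSpace

/-- A function into a normed group is bounded. -/
def IsBddFun {X E : Type*} [Norm E] (φ : X → E) : Prop := ∃ C, ∀ x, ‖φ x‖ ≤ C

namespace IsBddFun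

variable {X E R : Type*}

lemma const [Norm E] (e : E) : IsBddFun (fun _ : X => e) := ⟨‖e‖, fun _ => le_rfl⟩

lemma add [SeminormedAddCommGroup E] {φ ψ : X → E} (hφ : IsBddFun φ) (hψ : IsBddFun ψ) :
    IsBddFun (fun x => φ x + ψ x) := by
  obtain ⟨C, hC⟩ := hφ
  obtain ⟨D, hD⟩ := hψ
  exact ⟨C + D, fun x => (norm_add_le _ _).trans (add_le_add (hC x) (hD x))⟩

lemma mul [SeminormedRing R] {φ ψ : X → R} (hφ : IsBddFun φ) (hψ : IsBddFun ψ) :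
    IsBddFun (fun x => φ x * ψ x) := by
  obtain ⟨C, hC⟩ := hφ
  obtain ⟨D, hD⟩ := hψ
  refine ⟨C * D, fun x => (norm_mul_le _ _).trans ?_⟩
  exact mul_le_mul (hC x) (hD x) (norm_nonneg _) ((norm_nonneg _).trans (hC x))

lemma neg [SeminormedAddCommGroup E] {φ : X → E} (hφ : IsBddFun φ) :
    IsBddFun (fun x => -φ x) := by
  obtain ⟨C, hC⟩ := hφ
  exact ⟨C, fun x => by simpa using hC x⟩

lemma sub [SeminormedAddCommGroup E] {φ ψ : X → E} (hφ : IsBddFun φ) (hψ : IsBddFun ψ) :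
    IsBddFun (fun x => φ x - ψ x) := by
  simpa only [sub_eq_add_neg] using hφ.add hψ.neg

lemma star [NormedRing R] [StarRing R] [NormedStarGroup R] {φ : X → R}
    (hφ : IsBddFun φ) : IsBddFun (fun x => Star.star (φ x)) := by
  obtain ⟨C, hC⟩ := hφ
  exact ⟨C, fun x => by simpa using hC x⟩

lemma comp {Y : Type*} [Norm E] {φ : X → E} (hφ : IsBddFun φ) (t : Y → X) :
    IsBddFun (fun y => φ (t y)) := by
  obtain ⟨C, hC⟩ := hφ
  exact ⟨C, fun y => hC (t y)⟩

lemma re {φ : X → ℂ} (hφ : IsBddFun φ) : IsBddR (fun x => (φ x).re) := by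
  obtain ⟨C, hC⟩ := hφ
  exact ⟨C, fun x => (Complex.abs_re_le_norm _).trans (hC x)⟩

lemma im {φ : X → ℂ} (hφ : IsBddFun φ) : IsBddR (fun x => (φ x).im) := by
  obtain ⟨C, hC⟩ := hφ
  exact ⟨C, fun x => (Complex.abs_im_le_norm _).trans (hC x)⟩

lemma inner_apply {V : Type*} [NormedAddCommGroup V] [InnerProductSpace ℂ V]
    {a : X → V →L[ℂ] V} (ha : IsBddFun a) (v w : V) : IsBddFun (fun x => ⟪a x v, w⟫_ℂ) := by
  obtain ⟨C, hC⟩ := ha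
  refine ⟨C * ‖v‖ * ‖w‖, fun x => (norm_inner_le_norm _ _).trans ?_⟩
  gcongr
  exact (a x).le_of_opNorm_le (hC x) v

end IsBddFun

lemma IsBddR.const_mul {X : Type*} {φ : X → ℝ} (r : ℝ) (hφ : IsBddR φ) :
    IsBddR (fun x => r * φ x) := by
  obtain ⟨C, hC⟩ := hφ
  refine ⟨|r| * C, fun x => ?_⟩
  rw [abs_mul]
  gcongr
  exact hC x

namespace Mean

variable {X : Type*} (m : Mean X)

lemma app_const (r : ℝ) : m.app (fun _ => r) = r := by
  simpa [m.app_one] using m.app_smul r (fun _ => 1) ⟨1, fun _ => by simp⟩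

lemma app_sub {φ ψ : X → ℝ} (hφ : IsBddR φ) (hψ : IsBddR ψ) :
    m.app (fun x => φ x - ψ x) = m.app φ - m.app ψ := by
  have h := m.app_add φ (fun x => -1 * ψ x) hφ (hψ.const_mul _)
  rw [m.app_smul _ _ hψ] at h
  simpa [sub_eq_add_neg] using h

lemma abs_app_le {φ : X → ℝ} {C : ℝ} (h : ∀ x, |φ x| ≤ C) : |m.app φ| ≤ C := by
  have hφ : IsBddFun φ := ⟨C, h⟩
  have hC : IsBddFun (fun _ : X => C) := .const C
  have h₁ := m.app_nonneg (fun x => C - φ x) (hC.sub hφ) fun x => sub_nonneg.2 (abs_le.1 (h x)).2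
  have h₂ := m.app_nonneg (fun x => C + φ x) (hC.add hφ) fun x => by linarith [(abs_le.1 (h x)).1]
  rw [m.app_sub hC hφ, m.app_const] at h₁
  rw [m.app_add _ _ hC hφ, m.app_const] at h₂
  exact abs_le.2 ⟨by linarith, by linarith⟩

/-- The complex-linear extension of a mean. -/
def capp (φ : X → ℂ) : ℂ := ⟨m.app fun x => (φ x).re, m.app fun x => (φ x).im⟩

lemma capp_const (z : ℂ) : m.capp (fun _ => z) = z := by
  simp [capp, app_const]

lemma capp_add {φ ψ : X → ℂ} (hφ : IsBddFun φ) (hψ : IsBddFun ψ) :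
    m.capp (fun x => φ x + ψ x) = m.capp φ + m.capp ψ := by
  apply Complex.ext
  · exact m.app_add _ _ hφ.re hψ.re
  · exact m.app_add _ _ hφ.im hψ.im

lemma capp_const_mul (z : ℂ) {φ : X → ℂ} (hφ : IsBddFun φ) :
    m.capp (fun x => z * φ x) = z * m.capp φ := by
  apply Complex.ext
  · simp only [capp, Complex.mul_re]
    rw [m.app_sub (hφ.re.const_mul _) (hφ.im.const_mul _), m.app_smul _ _ hφ.re,
      m.app_smul _ _ hφ.im]
  · simp only [capp, Complex.mul_im]
    rw [m.app_add _ _ (hφ.im.const_mul _) (hφ.re.const_mul _), m.app_smul _ _ hφ.re,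
      m.app_smul _ _ hφ.im]

lemma capp_conj {φ : X → ℂ} (hφ : IsBddFun φ) :
    m.capp (fun x => (starRingEnd ℂ) (φ x)) = (starRingEnd ℂ) (m.capp φ) := by
  apply Complex.ext
  · simp [capp]
  · simpa [capp] using m.app_smul (-1) _ hφ.im

lemma norm_capp_le {φ : X → ℂ} {C : ℝ} (h : ∀ x, ‖φ x‖ ≤ C) : ‖m.capp φ‖ ≤ 2 * C := by
  refine (Complex.norm_le_abs_re_add_abs_im _).trans ?_
  have h₁ : |(m.capp φ).re| ≤ C :=
    m.abs_app_le fun x => (Complex.abs_re_le_norm _).trans (h x)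
  have h₂ : |(m.capp φ).im| ≤ C :=
    m.abs_app_le fun x => (Complex.abs_im_le_norm _).trans (h x)
  linarith

variable {V : Type*} [NormedAddCommGroup V] [InnerProductSpace ℂ V] [CompleteSpace V]

lemma exists_op {a : X → V →L[ℂ] V} (ha : IsBddFun a) :
    ∃ T : V →L[ℂ] V, ∀ v w, ⟪T v, w⟫_ℂ = m.capp (fun x => ⟪a x v, w⟫_ℂ) := by
  let B : V →ₗ⋆[ℂ] V →ₗ[ℂ] ℂ :=
    LinearMap.mk₂'ₛₗ (starRingEnd ℂ) (RingHom.id ℂ) (fun v w => m.capp (fun x => ⟪a x v, w⟫_ℂ))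
      (fun v v' w => by
        simp only [map_add, inner_add_left]
        exact m.capp_add (ha.inner_apply _ _) (ha.inner_apply _ _))
      (fun z v w => by
        simp only [map_smul, inner_smul_left]
        exact m.capp_const_mul _ (ha.inner_apply _ _))
      (fun v w w' => by
        simp only [inner_add_right]
        exact m.capp_add (ha.inner_apply _ _) (ha.inner_apply _ _))
      (fun z v w => by
        simp only [inner_smul_right]
        exact m.capp_const_mul _ (ha.inner_apply _ _))
  have hB : ∃ C, ∀ v w, ‖B v w‖ ≤ C * ‖v‖ * ‖w‖ := by
    obtain ⟨C, hC⟩ := ha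
    refine ⟨2 * C, fun v w => ?_⟩
    have : ∀ x, ‖⟪a x v, w⟫_ℂ‖ ≤ C * ‖v‖ * ‖w‖ := fun x => by
      refine (norm_inner_le_norm _ _).trans ?_
      gcongr
      exact (a x).le_of_opNorm_le (hC x) v
    calc ‖B v w‖ ≤ 2 * (C * ‖v‖ * ‖w‖) := m.norm_capp_le this
      _ = _ := by ring
  obtain ⟨C, hC⟩ := hB
  exact ⟨InnerProductSpace.continuousLinearMapOfBilin (B.mkContinuous₂ C hC), fun v w => by
    rw [InnerProductSpace.continuousLinearMapOfBilin_apply]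
    rfl⟩

open Classical in
/-- The weak mean of a bounded family of operators (zero if the family is unbounded). -/
noncomputable def op (a : X → V →L[ℂ] V) : V →L[ℂ] V :=
  if ha : IsBddFun a then (m.exists_op ha).choose else 0

variable {a b : X → V →L[ℂ] V}

lemma inner_op (ha : IsBddFun a) (v w : V) :
    ⟪m.op a v, w⟫_ℂ = m.capp (fun x => ⟪a x v, w⟫_ℂ) := by
  rw [op, dif_pos ha]
  exact (m.exists_op ha).choose_spec v w

lemma op_eq (ha : IsBddFun a) {T : V →L[ℂ] V}
    (h : ∀ v w, m.capp (fun x => ⟪a x v, w⟫_ℂ) = ⟪T v, w⟫_ℂ) : m.op a = T := by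
  ext v
  exact ext_inner_right ℂ fun w => by rw [m.inner_op ha, h]

lemma op_const (T : V →L[ℂ] V) : m.op (fun _ => T) = T :=
  m.op_eq (.const T) fun _ _ => m.capp_const _

lemma op_add (ha : IsBddFun a) (hb : IsBddFun b) :
    m.op (fun x => a x + b x) = m.op a + m.op b :=
  m.op_eq (ha.add hb) fun v w => by
    simp only [add_apply, inner_add_left, m.inner_op ha, m.inner_op hb]
    exact m.capp_add (ha.inner_apply _ _) (hb.inner_apply _ _)

lemma op_mul_const (ha : IsBddFun a) (T : V →L[ℂ] V) :
    m.op (fun x => a x * T) = m.op a * T :=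
  m.op_eq (ha.mul (.const T)) fun v w => by
    simp only [mul_apply_eq_comp, m.inner_op ha]

lemma op_const_mul (T : V →L[ℂ] V) (ha : IsBddFun a) :
    m.op (fun x => T * a x) = T * m.op a :=
  m.op_eq ((IsBddFun.const T).mul ha) fun v w => by
    simp only [mul_apply_eq_comp, ← ContinuousLinearMap.adjoint_inner_right,
      m.inner_op ha]

lemma op_star (ha : IsBddFun a) : m.op (fun x => star (a x)) = star (m.op a) :=
  m.op_eq ha.star fun v w => by
    simp only [ContinuousLinearMap.star_eq_adjoint, ContinuousLinearMap.adjoint_inner_left]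
    rw [← inner_conj_symm, m.inner_op ha, ← m.capp_conj (ha.inner_apply _ _)]
    simp only [inner_conj_symm]

lemma op_sub (ha : IsBddFun a) (hb : IsBddFun b) :
    m.op (fun x => a x - b x) = m.op a - m.op b := by
  rw [eq_sub_iff_add_eq, ← m.op_add (ha.sub hb) hb]
  simp

lemma norm_op_le {C : ℝ} (hC : 0 ≤ C) (h : ∀ x, ‖a x‖ ≤ C) : ‖m.op a‖ ≤ 2 * C := by
  refine ContinuousLinearMap.opNorm_le_bound _ (by positivity) fun v => ?_
  set w := m.op a v with hw
  have h₁ : ‖⟪w, w⟫_ℂ‖ ≤ 2 * (C * ‖v‖ * ‖w‖) := by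
    conv_lhs => rw [hw, m.inner_op ⟨C, h⟩]
    refine m.norm_capp_le fun x => (norm_inner_le_norm _ _).trans ?_
    gcongr
    exact (a x).le_of_opNorm_le (h x) v
  rw [inner_self_eq_norm_sq_to_K, norm_pow, RCLike.norm_ofReal, abs_norm] at h₁
  rcases (norm_nonneg w).eq_or_lt with h₀ | h₀
  · rw [← h₀]; positivity
  · nlinarith

lemma norm_op_sub_le {C : ℝ} (hC : 0 ≤ C) {T : V →L[ℂ] V} (h : ∀ x, ‖a x - T‖ ≤ C) :
    ‖m.op a - T‖ ≤ 2 * C := by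
  have ha : IsBddFun a := by
    simpa using (show IsBddFun (fun x => a x - T) from ⟨C, h⟩).add (.const T)
  rw [← m.op_const T, ← m.op_sub ha (.const T)]
  exact m.norm_op_le hC h

/-- The mean is multiplicative up to a quadratic error. -/
lemma norm_op_mul_sub_le {C : ℝ} (hC : 0 ≤ C) (ha : ∀ x, ‖a x - m.op a‖ ≤ C)
    (hb : ∀ x, ‖b x - m.op b‖ ≤ C) :
    ‖m.op (fun x => a x * b x) - m.op a * m.op b‖ ≤ 2 * C ^ 2 := by
  have ha' : IsBddFun (fun x => a x - m.op a) := ⟨C, ha⟩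
  have hb' : IsBddFun (fun x => b x - m.op b) := ⟨C, hb⟩
  have hab : IsBddFun a := by simpa using ha'.add (.const (m.op a))
  have hbb : IsBddFun b := by simpa using hb'.add (.const (m.op b))
  have h : m.op (fun x => (a x - m.op a) * (b x - m.op b)) =
      m.op (fun x => a x * b x) - m.op a * m.op b := by
    have e : ∀ x, (a x - m.op a) * (b x - m.op b) =
        a x * b x - m.op a * b x - (a x - m.op a) * m.op b := fun x => by noncomm_ring
    simp only [e]
    rw [m.op_sub ((hab.mul hbb).sub ((IsBddFun.const _).mul hbb)) (ha'.mul (.const _)),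
      m.op_sub (hab.mul hbb) ((IsBddFun.const _).mul hbb), m.op_const_mul _ hbb,
      m.op_mul_const ha', m.op_sub hab (.const _), m.op_const]
    simp
  rw [← h]
  refine m.norm_op_le (by positivity) fun x => (norm_mul_le _ _).trans ?_
  rw [pow_two]
  exact mul_le_mul (ha x) (hb x) (norm_nonneg _) hC

end Mean

lemma InvariantMean.op_left {G : Type*} [Group G] (m : InvariantMean G) {V : Type*}
    [NormedAddCommGroup V] [InnerProductSpace ℂ V] [CompleteSpace V] {a : G → V →L[ℂ] V}
    (ha : IsBddFun a) (k : G) : m.op (fun g => a (k * g)) = m.op a :=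
  m.op_eq (ha.comp _) fun v w => by
    rw [m.inner_op ha]
    apply Complex.ext
    · exact m.app_left k _ (ha.inner_apply v w).re
    · exact m.app_left k _ (ha.inner_apply v w).im

section UnitaryPart

variable {A : Type*} [CStarAlgebra A]

/-- The unitary part in the polar decomposition of an invertible element. -/
noncomputable def unitaryPart (T : A) : A := T * cfc (fun x : ℝ => (√x)⁻¹) (star T * T)

lemma abs_sub_one_le_of_mem_spectrum {a : A} {x : ℝ} (hx : x ∈ spectrum ℝ a) :
    |x - 1| ≤ ‖a - 1‖ := by
  obtain h | h := subsingleton_or_nontrivial A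
  · simp [spectrum.of_subsingleton] at hx
  · have := spectrum.add_mem_iff (a := a) (r := x - 1) (s := (1 : ℝ))
    rw [sub_add_cancel, map_one, ← sub_eq_neg_add] at this
    exact spectrum.norm_le_norm_of_mem (this.1 hx)

lemma abs_inv_sqrt_sub_one_le {x : ℝ} (hx : |x - 1| ≤ 1 / 2) : |(√x)⁻¹ - 1| ≤ |x - 1| := by
  have h0 : 1 / 2 ≤ x := by linarith [(abs_le.1 hx).1]
  set s := √x with hs
  have hsx : s ^ 2 = x := Real.sq_sqrt (by linarith)
  have hs0 : 0 ≤ s := Real.sqrt_nonneg x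
  have hs1 : 1 / 2 ≤ s := by nlinarith
  have e : x - 1 = -(s ^ 2 + s) * (s⁻¹ - 1) := by
    rw [← hsx]; field_simp; ring
  rw [e, abs_mul, abs_neg]
  refine le_mul_of_one_le_left (abs_nonneg _) ?_
  rw [abs_of_nonneg (by positivity)]
  linarith

variable {T : A} {η : ℝ}

lemma norm_unitaryPart_sub_le (hT : ‖star T * T - 1‖ ≤ η) (hη : η ≤ 1 / 2) :
    ‖unitaryPart T - T‖ ≤ ‖T‖ * η := by
  have hsp : ∀ x ∈ spectrum ℝ (star T * T), |x - 1| ≤ η := fun x hx =>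
    (abs_sub_one_le_of_mem_spectrum hx).trans hT
  have hc : ContinuousOn (fun x : ℝ => (√x)⁻¹) (spectrum ℝ (star T * T)) := by
    refine Real.continuous_sqrt.continuousOn.inv₀ fun x hx => (Real.sqrt_pos.2 ?_).ne'
    linarith [(abs_le.1 (hsp x hx)).1]
  have : unitaryPart T - T = T * cfc (fun x : ℝ => (√x)⁻¹ - 1) (star T * T) := by
    rw [cfc_sub _ _ _ hc (by fun_prop), cfc_const_one ℝ (star T * T), mul_sub, mul_one, unitaryPart]
  rw [this]
  refine (norm_mul_le _ _).trans ?_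
  gcongr
  refine norm_cfc_le ((norm_nonneg _).trans hT) fun x hx => ?_
  exact (abs_inv_sqrt_sub_one_le ((hsp x hx).trans hη)).trans (hsp x hx)

lemma unitaryPart_mem_unitary (hT : ‖star T * T - 1‖ ≤ 1 / 2) (hu : IsUnit T) :
    unitaryPart T ∈ unitary A := by
  have hsp : ∀ x ∈ spectrum ℝ (star T * T), 0 < x := fun x hx => by
    linarith [(abs_le.1 ((abs_sub_one_le_of_mem_spectrum hx).trans hT)).1]
  have hc : ContinuousOn (fun x : ℝ => (√x)⁻¹) (spectrum ℝ (star T * T)) :=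
    Real.continuous_sqrt.continuousOn.inv₀ fun x hx => (Real.sqrt_pos.2 (hsp x hx)).ne'
  set s := cfc (fun x : ℝ => (√x)⁻¹) (star T * T) with hs
  have hsa : star s = s := (cfc_predicate (R := ℝ) _ (star T * T) : IsSelfAdjoint s)
  have hT' : cfc (fun x : ℝ => x) (star T * T) = star T * T := cfc_id' ℝ _
  have h₁ : s * (star T * T) * s = 1 := by
    conv_lhs => rw [← hT']
    rw [hs, ← cfc_mul _ _ _ hc (continuousOn_id' _),
      ← cfc_mul (fun x => (√x)⁻¹ * x) _ _ (hc.mul (continuousOn_id' _)) hc,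
      ← cfc_const_one ℝ (star T * T)]
    refine cfc_congr fun x hx => ?_
    have := Real.sq_sqrt (hsp x hx).le
    have h0 := (Real.sqrt_pos.2 (hsp x hx)).ne'
    field_simp
    exact this.symm
  have h₂ : s * s * star T * T = 1 := by
    conv_lhs => rw [mul_assoc, ← hT']
    rw [hs, ← cfc_mul _ _ _ hc hc,
      ← cfc_mul (fun x => (√x)⁻¹ * (√x)⁻¹) _ _ (hc.mul hc) (continuousOn_id' _),
      ← cfc_const_one ℝ (star T * T)]
    refine cfc_congr fun x hx => ?_
    have := Real.sq_sqrt (hsp x hx).le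
    have h0 := (Real.sqrt_pos.2 (hsp x hx)).ne'
    field_simp
    exact this.symm
  have h₃ : T * (s * s * star T) = 1 := by
    obtain ⟨u, rfl⟩ := hu
    rw [Units.eq_inv_of_mul_eq_one_right h₂, Units.mul_inv]
  rw [Unitary.mem_iff, unitaryPart, ← hs, star_mul, hsa]
  exact ⟨by rw [← h₁]; noncomm_ring, by rw [← h₃]; noncomm_ring⟩

lemma unitaryPart_one : unitaryPart (1 : A) = 1 := by
  have := norm_unitaryPart_sub_le (T := (1 : A)) (η := 0) (by simp) (by norm_num)
  rw [mul_zero, norm_le_zero_iff, sub_eq_zero] at this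
  exact this

lemma Commute.unitaryPart {b : A} (h : Commute b T) (h' : Commute b (star T)) :
    Commute b (unitaryPart T) := by
  refine h.mul_right (Commute.cfc_real ?_ _).symm
  exact (h'.mul_right h).symm

end UnitaryPart

section UnitaryMetric

variable {A : Type*} [CStarAlgebra A]

instance : IsIsometricSMul (unitary A) (unitary A) where
  isometry_smul c := Isometry.of_dist_eq fun u v => by
    simp only [Subtype.dist_eq, dist_eq_norm, smul_eq_mul, Submonoid.coe_mul, ← mul_sub]
    exact CStarRing.norm_coe_unitary_mul _ _

instance : IsIsometricSMul (unitary A)ᵐᵒᵖ (unitary A) where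
  isometry_smul c := Isometry.of_dist_eq fun u v => by
    simp only [Subtype.dist_eq, dist_eq_norm, MulOpposite.smul_eq_mul_unop, Submonoid.coe_mul,
      ← sub_mul]
    exact CStarRing.norm_mul_coe_unitary _ _

instance : CompleteSpace (unitary A) := isClosed_unitary.completeSpace_coe

lemma Unitary.dist_eq_norm_sub (u v : unitary A) : dist u v = ‖(u : A) - v‖ := by
  rw [Subtype.dist_eq, dist_eq_norm]

lemma isUnit_of_norm_sub_unitary_lt_one {T : A} (u : unitary A) (h : ‖T - u‖ < 1) :
    IsUnit T := by
  have h' : ‖star (u : A) * (u - T)‖ < 1 := by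
    rwa [← Unitary.coe_star, CStarRing.norm_coe_unitary_mul, norm_sub_rev]
  have e : T = u * (1 - star (u : A) * (u - T)) := by
    rw [mul_sub, ← mul_assoc, Unitary.mul_star_self_of_mem u.2]
    simp
  rw [e]
  exact (Unitary.toUnits u).isUnit.mul (isUnit_one_sub_of_norm_lt_one h')

end UnitaryMetric

section

variable {V : Type*} [NormedAddCommGroup V] [InnerProductSpace ℂ V] [CompleteSpace V]

lemma norm_coe_unitary_le (u : unitary (V →L[ℂ] V)) : ‖(u : V →L[ℂ] V)‖ ≤ 1 := by
  rw [← mul_one (u : V →L[ℂ] V), CStarRing.norm_coe_unitary_mul]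
  exact ContinuousLinearMap.norm_id_le

lemma IsBddFun.coe_unitary {X : Type*} (a : X → unitary (V →L[ℂ] V)) :
    IsBddFun (fun x => (a x : V →L[ℂ] V)) :=
  ⟨1, fun x => norm_coe_unitary_le (a x)⟩

/-- Averaging a nearly constant unitary cocycle gives a map whose defect is quadratically small. -/
lemma InvariantMean.exists_unitary_map {G L : Type*} [Group G] [Group L] (m : InvariantMean G)
    (t : L → G) (a : L → G → unitary (V →L[ℂ] V))
    (hcoc : ∀ x y g, a (x * y) g = a x (t y * g) * a y g) {η : ℝ} (hη : η ≤ 1 / 16)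
    (ha : ∀ x g g', dist (a x g) (a x g') ≤ η) :
    ∃ u : L → unitary (V →L[ℂ] V), u 1 = 1 ∧ (∀ x g, dist (u x) (a x g) ≤ 3 * η) ∧
      (∀ x y, dist (u (x * y)) (u x * u y) ≤ 72 * η ^ 2) ∧
      ∀ (b : unitary (V →L[ℂ] V)) (k : G) (x : L),
        (∀ g, b * a x g * star b = a x (k * g)) → Commute b (u x) := by
  have hη0 : 0 ≤ η := dist_nonneg.trans (ha 1 1 1)
  set M : L → V →L[ℂ] V := fun x => m.op (fun g => (a x g : V →L[ℂ] V)) with hM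
  have hMa : ∀ x g, ‖M x - a x g‖ ≤ 2 * η := fun x g =>
    m.norm_op_sub_le hη0 fun g' => by
      rw [← Unitary.dist_eq_norm_sub]
      exact ha x g' g
  have haM : ∀ x g, ‖(a x g : V →L[ℂ] V) - M x‖ ≤ 2 * η := fun x g => by
    rw [norm_sub_rev]
    exact hMa x g
  have hMn : ∀ x, ‖M x‖ ≤ 2 := fun x => by
    have h := norm_le_norm_add_norm_sub' (M x) (a x 1)
    linarith [hMa x 1, norm_coe_unitary_le (a x 1)]
  have hstar : ∀ x, m.op (fun g => star (a x g : V →L[ℂ] V)) = star (M x) := fun x =>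
    m.op_star (.coe_unitary _)
  have hMM : ∀ x, ‖star (M x) * M x - 1‖ ≤ 8 * η ^ 2 := fun x => by
    have h := m.norm_op_mul_sub_le (a := fun g => star (a x g : V →L[ℂ] V))
      (b := fun g => (a x g : V →L[ℂ] V)) (C := 2 * η) (by positivity)
      (fun g => by
        rw [hstar, ← star_sub, norm_star]
        exact haM x g) (haM x)
    simp only [hstar, Unitary.coe_star_mul_self, m.op_const] at h
    rw [norm_sub_rev]
    linarith
  have hMmul : ∀ x y, ‖M (x * y) - M x * M y‖ ≤ 8 * η ^ 2 := fun x y => by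
    have hinv : m.op (fun g => (a x (t y * g) : V →L[ℂ] V)) = M x :=
      m.op_left (a := fun g => (a x g : V →L[ℂ] V)) (.coe_unitary _) (t y)
    have h := m.norm_op_mul_sub_le (a := fun g => (a x (t y * g) : V →L[ℂ] V))
      (b := fun g => (a y g : V →L[ℂ] V)) (C := 2 * η) (by positivity)
      (fun g => by
        rw [hinv]
        exact haM x _) (haM y)
    rw [hinv] at h
    simp only [hM, hcoc, Submonoid.coe_mul]
    linarith
  have hη2 : 8 * η ^ 2 ≤ 1 / 2 := by nlinarith
  have hU : ∀ x, unitaryPart (M x) ∈ unitary (V →L[ℂ] V) := fun x =>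
    unitaryPart_mem_unitary ((hMM x).trans hη2)
      (isUnit_of_norm_sub_unitary_lt_one (a x 1) ((hMa x 1).trans_lt (by linarith)))
  have hUM : ∀ x, ‖unitaryPart (M x) - M x‖ ≤ 16 * η ^ 2 := fun x => by
    refine (norm_unitaryPart_sub_le (hMM x) hη2).trans ?_
    nlinarith [hMn x, sq_nonneg η]
  refine ⟨fun x => ⟨_, hU x⟩, ?_, fun x g => ?_, fun x y => ?_, fun b k x hb => ?_⟩
  · have h1 : ∀ g, a 1 g = 1 := fun g => by
      have h := hcoc 1 1 ((t 1)⁻¹ * g)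
      rw [one_mul, mul_inv_cancel_left] at h
      rw [← mul_inv_cancel_right (a 1 g) (a 1 ((t 1)⁻¹ * g)), ← h, mul_inv_cancel]
    ext1
    simp only [hM, h1, OneMemClass.coe_one, m.op_const, unitaryPart_one]
  · rw [Unitary.dist_eq_norm_sub]
    have h := norm_sub_le_norm_sub_add_norm_sub (unitaryPart (M x)) (M x) (a x g)
    have := hUM x
    have := hMa x g
    dsimp only
    nlinarith
  · rw [Unitary.dist_eq_norm_sub]
    have e : unitaryPart (M (x * y)) - unitaryPart (M x) * unitaryPart (M y) =
        (unitaryPart (M (x * y)) - M (x * y)) + (M (x * y) - M x * M y)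
        - (M x * (unitaryPart (M y) - M y)) - (unitaryPart (M x) - M x) * unitaryPart (M y) := by
      noncomm_ring
    have h₁ : ‖M x * (unitaryPart (M y) - M y)‖ ≤ 2 * (16 * η ^ 2) :=
      (norm_mul_le _ _).trans (mul_le_mul (hMn x) (hUM y) (norm_nonneg _) zero_le_two)
    have h₂ : ‖(unitaryPart (M x) - M x) * unitaryPart (M y)‖ ≤ 16 * η ^ 2 := by
      rw [CStarRing.norm_mul_mem_unitary _ (hU y)]
      exact hUM x
    have h₃ := hUM (x * y)
    have h₄ := hMmul x y
    simp only [Submonoid.coe_mul]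
    rw [e]
    refine (norm_sub_le _ _).trans ?_
    have h₅ := norm_sub_le ((unitaryPart (M (x * y)) - M (x * y)) + (M (x * y) - M x * M y))
      (M x * (unitaryPart (M y) - M y))
    have h₆ := norm_add_le (unitaryPart (M (x * y)) - M (x * y)) (M (x * y) - M x * M y)
    linarith
  · have hconj : (b : V →L[ℂ] V) * M x * star (b : V →L[ℂ] V) = M x := by
      have h := m.op_left (a := fun g => (a x g : V →L[ℂ] V)) (.coe_unitary _) k
      simp only [← hb, Submonoid.coe_mul, Unitary.coe_star] at h
      rwa [m.op_mul_const ((IsBddFun.const _).mul (.coe_unitary _)),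
        m.op_const_mul _ (.coe_unitary _)] at h
    have hcomm : ∀ T : V →L[ℂ] V, (b : V →L[ℂ] V) * T * star (b : V →L[ℂ] V) = T →
        Commute (b : V →L[ℂ] V) T := fun T hT => by
      have h := congrArg (· * (b : V →L[ℂ] V)) hT
      simpa [mul_assoc, commute_iff_eq] using h
    have hconj' := congrArg star hconj
    simp only [star_mul, star_star, ← mul_assoc] at hconj'
    exact Subtype.ext ((hcomm _ hconj).unitaryPart (hcomm _ hconj'))

end

section Iteration

open Filter Topology

/-- A predicate on maps into a complete space that can be improved geometrically by small
perturbations can be satisfied at all scales near a limiting map. -/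
lemma exists_limit_of_geometric {L Y : Type*} [MetricSpace Y] [CompleteSpace Y]
    (P : (L → Y) → ℝ → Prop) (K η₀ : ℝ)
    (step : ∀ f η, 0 ≤ η → η ≤ η₀ → P f η → ∃ f', P f' (η / 2) ∧ ∀ x, dist (f x) (f' x) ≤ K * η)
    {f : L → Y} {η : ℝ} (h0 : 0 ≤ η) (hη : η ≤ η₀) (hf : P f η) :
    ∃ F : L → Y, (∀ x, dist (f x) (F x) ≤ 2 * K * η) ∧
      ∃ s : ℕ → L → Y, (∀ n, P (s n) (η / 2 ^ n)) ∧
        ∀ x, Tendsto (fun n => s n x) atTop (𝓝 (F x)) := by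
  have hle : ∀ n : ℕ, η / 2 ^ n ≤ η₀ := fun n =>
    (div_le_self h0 (one_le_pow₀ one_le_two)).trans hη
  choose! next hnext hdist using step
  let s : ℕ → L → Y := fun n => Nat.rec f (fun n f => next f (η / 2 ^ n)) n
  have hs : ∀ n, P (s n) (η / 2 ^ n) := fun n => by
    induction n with
    | zero => simpa [s] using hf
    | succ n ih =>
      have := hnext (s n) _ (by positivity) (hle n) ih
      rwa [div_div, ← pow_succ] at this
  have hd : ∀ x n, dist (s n x) (s (n + 1) x) ≤ 2 * K * η / 2 / 2 ^ n := fun x n =>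
    (hdist (s n) _ (by positivity) (hle n) (hs n) x).trans_eq (by ring)
  choose F hF using fun x => cauchySeq_tendsto_of_complete (cauchySeq_of_le_geometric_two (hd x))
  exact ⟨F, fun x => dist_le_of_le_geometric_two_of_tendsto₀ (hd x) (hF x), s, hs, hF⟩

lemma tendsto_div_two_pow (η : ℝ) : Tendsto (fun n : ℕ => η / 2 ^ n) atTop (𝓝 0) := by
  simpa [div_eq_mul_inv] using
    (tendsto_pow_atTop_nhds_zero_of_lt_one (r := (2 : ℝ)⁻¹) (by norm_num) (by norm_num)).const_mul η

end Iteration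

section Stability

open Filter Topology

variable {V : Type*} [NormedAddCommGroup V] [InnerProductSpace ℂ V] [CompleteSpace V]

/-- Amenable groups are strongly Ulam stable with a linear modulus. -/
lemma InvariantMean.exists_monoidHom_near {G : Type*} [Group G] (m : InvariantMean G) {ε : ℝ}
    (hε : ε ≤ 1 / 576) (f : G → unitary (V →L[ℂ] V))
    (hf : ∀ x y, dist (f (x * y)) (f x * f y) ≤ ε) :
    ∃ π : G →* unitary (V →L[ℂ] V), ∀ x, dist (f x) (π x) ≤ 14 * ε := by
  have hε0 : 0 ≤ ε := dist_nonneg.trans (hf 1 1)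
  obtain ⟨F, hF, s, hs, hlim⟩ := exists_limit_of_geometric
    (P := fun (f : G → unitary (V →L[ℂ] V)) ε => ∀ x y, dist (f (x * y)) (f x * f y) ≤ ε)
    7 (1 / 576) (fun f ε h0 hε hf => by
      have hfa : ∀ x g, dist (f (x * g) * (f g)⁻¹) (f x) ≤ ε := fun x g => by
        rw [← dist_mul_right _ _ (f g), inv_mul_cancel_right]
        exact hf x g
      obtain ⟨u, -, hu, hmul, -⟩ := m.exists_unitary_map (L := G) (fun y => y)
        (fun x g => f (x * g) * (f g)⁻¹)
        (fun x y g => by simp only [← mul_assoc, inv_mul_cancel_right])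
        (η := 2 * ε) (by linarith)
        (fun x g g' => (dist_triangle_right _ _ (f x)).trans (by linarith [hfa x g, hfa x g']))
      refine ⟨u, fun x y => (hmul x y).trans (by nlinarith), fun x => ?_⟩
      have h := dist_triangle_left (f x) (u x) (f (x * 1) * (f 1)⁻¹)
      have hu' := hu x 1
      rw [dist_comm] at hu'
      linarith [hfa x 1]) hε0 hε hf
  have hFmul : ∀ x y, F (x * y) = F x * F y := fun x y => by
    have h := le_of_tendsto_of_tendsto' ((hlim (x * y)).dist ((hlim x).mul (hlim y)))
      (tendsto_div_two_pow ε) fun n => hs n x y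
    exact dist_le_zero.1 h
  exact ⟨MonoidHom.mk' F hFmul, fun x => (hF x).trans_eq (by ring)⟩

/-- A representation almost commuting with a representation of an amenable group can be moved
into its commutant, provided almost representations are close to representations. -/
lemma InvariantMean.exists_commuting_monoidHom_near {G H : Type*} [Group G] [Group H]
    (m : InvariantMean G) {c ε₀ : ℝ} (hc : 1 ≤ c)
    (hH : ∀ (f : H → unitary (V →L[ℂ] V)) (ε : ℝ), ε ≤ ε₀ → f 1 = 1 →
      (∀ x y, dist (f (x * y)) (f x * f y) ≤ ε) →
      ∃ ρ : H →* unitary (V →L[ℂ] V), ∀ x, dist (f x) (ρ x) ≤ c * ε)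
    (π : G →* unitary (V →L[ℂ] V)) (ρ : H →* unitary (V →L[ℂ] V)) {η : ℝ}
    (hη : η ≤ min (1 / (1152 * c)) ε₀) (hρ : ∀ g h, dist (π g * ρ h) (ρ h * π g) ≤ η) :
    ∃ σ : H →* unitary (V →L[ℂ] V), (∀ g h, Commute (π g) (σ h)) ∧
      ∀ h, dist (ρ h) (σ h) ≤ 14 * η := by
  have hη0 : 0 ≤ η := dist_nonneg.trans (hρ 1 1)
  obtain ⟨F, hF, s, hs, hlim⟩ := exists_limit_of_geometric
    (P := fun (f : H → unitary (V →L[ℂ] V)) η => (∀ x y, f (x * y) = f x * f y) ∧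
      ∀ g h, dist (π g * f h) (f h * π g) ≤ η)
    7 (min (1 / (1152 * c)) ε₀) (fun f η h0 hη hf => by
      obtain ⟨hmul, hcomm⟩ := hf
      have hη₁ : 1152 * c * η ≤ 1 := by
        have := hη.trans (min_le_left _ _)
        rwa [le_div_iff₀ (by positivity), mul_comm] at this
      have hη₂ : 1152 * η ≤ 1 := by nlinarith
      have hfa : ∀ h g, dist (π g * f h * (π g)⁻¹) (f h) ≤ η := fun h g => by
        rw [← dist_mul_right _ _ (π g), inv_mul_cancel_right]
        exact hcomm g h
      obtain ⟨u, hu1, hu, humul, hucomm⟩ := m.exists_unitary_map (L := H) (fun _ => 1)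
        (fun h g => π g * f h * (π g)⁻¹)
        (fun x y g => by simp only [one_mul, hmul, ← mul_assoc, inv_mul_cancel_right])
        (η := 2 * η) (by linarith)
        (fun x g g' => (dist_triangle_right _ _ (f x)).trans (by linarith [hfa x g, hfa x g']))
      obtain ⟨r, hr⟩ := hH u (288 * η ^ 2)
        (le_trans (by nlinarith) (hη.trans (min_le_right _ _))) hu1
        (fun x y => (humul x y).trans (by nlinarith))
      have hsmall : c * (288 * η ^ 2) ≤ η / 4 := by nlinarith
      refine ⟨r, ⟨map_mul r, fun g h => ?_⟩, fun h => ?_⟩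
      · have hc : π g * u h = u h * π g := hucomm (π g) g h fun k => by
          simp only [map_mul, mul_inv_rev, mul_assoc]
          rfl
        calc dist (π g * r h) (r h * π g)
            ≤ dist (π g * r h) (π g * u h) + dist (u h * π g) (r h * π g) := by
              rw [← hc]
              exact dist_triangle _ _ _
          _ = 2 * dist (u h) (r h) := by
              rw [dist_mul_left, dist_mul_right, dist_comm (r h)]
              ring
          _ ≤ η / 2 := by linarith [hr h]
      · have h₁ := hu h 1
        simp only [map_one, one_mul, inv_one, mul_one] at h₁
        have h₂ := dist_triangle_left (f h) (r h) (u h)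
        linarith [hr h]) hη0 hη (f := ρ) ⟨map_mul ρ, hρ⟩
  refine ⟨MonoidHom.mk' F fun x y => ?_, fun g h => ?_, fun h => (hF h).trans_eq (by ring)⟩
  · refine tendsto_nhds_unique (hlim (x * y)) ?_
    simp only [(hs _).1]
    exact (hlim x).mul (hlim y)
  · have h := le_of_tendsto_of_tendsto'
      (((hlim h).const_mul (π g)).dist ((hlim h).mul_const (π g)))
      (tendsto_div_two_pow η) fun n => (hs n).2 g h
    exact dist_le_zero.1 h

end Stability

/-- If `G` admits an invariant mean (is amenable) and `H` is
strongly Ulam stable with a linear (`O(ε)`) modulus — i.e. there are `c ≥ 1` and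
`ε₀ > 0` such that any `ε₀`-almost-representation `f : H → U(ℋ)` of defect `≤ ε`
is `c·ε`-close to a representation — then `G × H` is strongly Ulam stable with a
linear modulus. -/
theorem product_preservation_linear (G H : Type*) [Group G] [Group H]
    (m : InvariantMean G) (c ε₀ : ℝ) (hc : 1 ≤ c) (hε₀ : 0 < ε₀)
    (hH : ∀ (ℋ : Type u) [NormedAddCommGroup ℋ] [InnerProductSpace ℂ ℋ] [CompleteSpace ℋ]
      (f : H → unitary (ℋ →L[ℂ] ℋ)) (ε : ℝ), ε ≤ ε₀ → f 1 = 1 →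
      (∀ x y : H,
        ‖(f (x * y) : ℋ →L[ℂ] ℋ) - (f x : ℋ →L[ℂ] ℋ) * (f y : ℋ →L[ℂ] ℋ)‖ ≤ ε) →
      ∃ ρ : H →* unitary (ℋ →L[ℂ] ℋ),
        ∀ x : H, ‖(f x : ℋ →L[ℂ] ℋ) - (ρ x : ℋ →L[ℂ] ℋ)‖ ≤ c * ε) :
    ∃ C ε₁ : ℝ, 0 < C ∧ 0 < ε₁ ∧
      ∀ (ℋ : Type u) [NormedAddCommGroup ℋ] [InnerProductSpace ℂ ℋ] [CompleteSpace ℋ]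
        (f : G × H → unitary (ℋ →L[ℂ] ℋ)) (ε : ℝ), ε ≤ ε₁ → f 1 = 1 →
        (∀ a b : G × H,
          ‖(f (a * b) : ℋ →L[ℂ] ℋ) - (f a : ℋ →L[ℂ] ℋ) * (f b : ℋ →L[ℂ] ℋ)‖ ≤ ε) →
        ∃ ρ : G × H →* unitary (ℋ →L[ℂ] ℋ),
          ∀ a : G × H, ‖(f a : ℋ →L[ℂ] ℋ) - (ρ a : ℋ →L[ℂ] ℋ)‖ ≤ C * ε := by
  have hc0 : 0 < c := by linarith
  refine ⟨464 * c, min (min (1 / 576) ε₀)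
    (min (1 / (1152 * c) / (32 * c)) (ε₀ / (32 * c))), by positivity, by positivity, ?_⟩
  intro V _ _ _ f ε hε hf1 hf
  simp only [le_min_iff] at hε
  obtain ⟨⟨hε₁, hε₂⟩, hε₃, hε₄⟩ := hε
  rw [le_div_iff₀' (by positivity)] at hε₃ hε₄
  simp only [← Submonoid.coe_mul, ← Unitary.dist_eq_norm_sub] at hf hH ⊢
  have hε0 : 0 ≤ ε := dist_nonneg.trans (hf 1 1)
  have hcε : ε ≤ c * ε := le_mul_of_one_le_left hε0 hc
  obtain ⟨π, hπ⟩ := m.exists_monoidHom_near hε₁ (fun g => f (g, 1))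
    fun x y => by simpa using hf (x, 1) (y, 1)
  obtain ⟨ρ, hρ⟩ := hH V (fun h => f (1, h)) ε hε₂ hf1
    fun x y => by simpa using hf (1, x) (1, y)
  have hl : ∀ g h, dist (f (g, h)) (f (g, 1) * f (1, h)) ≤ ε := fun g h => by
    simpa using hf (g, 1) (1, h)
  have hr : ∀ g h, dist (f (g, h)) (f (1, h) * f (g, 1)) ≤ ε := fun g h => by
    simpa using hf (1, h) (g, 1)
  have hmul : ∀ a b a' b' : unitary (V →L[ℂ] V),
      dist (a * b) (a' * b') ≤ dist a a' + dist b b' := fun a b a' b' => by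
    simpa using dist_triangle (a * b) (a' * b) (a' * b')
  obtain ⟨σ, hσ, hρσ⟩ := m.exists_commuting_monoidHom_near hc (hH V) π ρ (η := 32 * c * ε)
    (le_min hε₃ hε₄) fun g h => by
      have h₁ := dist_triangle_left (π g * ρ h) (ρ h * π g) (f (g, h))
      have h₂ := dist_triangle (f (g, h)) (f (g, 1) * f (1, h)) (π g * ρ h)
      have h₃ := dist_triangle (f (g, h)) (f (1, h) * f (g, 1)) (ρ h * π g)
      have h₄ := hmul (f (g, 1)) (f (1, h)) (π g) (ρ h)
      have h₅ := hmul (f (1, h)) (f (g, 1)) (ρ h) (π g)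
      linarith [hl g h, hr g h, hπ g, hρ h]
  refine ⟨MonoidHom.noncommCoprod π σ hσ, fun ⟨g, h⟩ => ?_⟩
  simp only [MonoidHom.noncommCoprod_apply]
  have h₁ := dist_triangle (f (g, h)) (f (g, 1) * f (1, h)) (π g * σ h)
  have h₂ := hmul (f (g, 1)) (f (1, h)) (π g) (σ h)
  have h₃ := dist_triangle (f (1, h)) (ρ h) (σ h)
  linarith [hl g h, hπ g, hρ h, hρσ h]
end

section
/- Let G be a group, let I be a nonempty linearly ordered set, and let (G_i)_{i∈I} be a monotone family of subgroups of G (i ≤ j implies G_i ⊆ G_j) whose union is all of G. Let d ≥ 1, let N be a norm on the space of d×d complex matrices (N(M) = 0 iff M = 0, N(M+M') ≤ N(M) + N(M'), N(z·M) = |z|·N(M) for z ∈ ℂ), and let F : [0,∞) → [0,∞) be any function. Suppose that for every i ∈ I, every ε ≥ 0, and every map f : G_i → U(d) into the group of d×d unitary matrices with f(1) = 1 and N(f(xy) − f(x)f(y)) ≤ ε for all x, y ∈ G_i, there exists a group homomorphism ρ : G_i → U(d) with N(f(x) − ρ(x)) ≤ F(ε) for all x ∈ G_i. Then the same holds for G: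 for every ε ≥ 0 and every map f : G → U(d) with f(1) = 1 and N(f(xy) − f(x)f(y)) ≤ ε for all x, y ∈ G, there exists a group homomorphism ρ : G → U(d) with N(f(x) − ρ(x)) ≤ F(ε) for all x ∈ G. -/
open Filter Topology

/-- Every seminorm on a finite-dimensional complex normed space is continuous. -/
theorem Seminorm.continuous_of_finiteDimensional_complex {V : Type*} [NormedAddCommGroup V]
    [NormedSpace ℂ V] [FiniteDimensional ℂ V] (p : Seminorm ℂ V) : Continuous p := by
  let : NormedSpace ℝ V := NormedSpace.restrictScalars ℝ ℂ V
  have : FiniteDimensional ℝ V := Module.Finite.trans (R := ℝ) ℂ V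
  have hp : ConvexOn ℝ Set.univ (p.restrictScalars ℝ) := (p.restrictScalars ℝ).convexOn
  exact (continuousOn_univ.mp (hp.continuousOn isOpen_univ) :)

/-- The group of unitary matrices over `ℝ` or `ℂ` is compact. -/
theorem Matrix.compactSpace_unitaryGroup (n 𝕜 : Type*) [Fintype n] [DecidableEq n] [RCLike 𝕜] :
    CompactSpace (Matrix.unitaryGroup n 𝕜) := by
  refine isCompact_iff_compactSpace.mp ?_
  have hbox : IsCompact (Set.univ.pi fun _ : n => Set.univ.pi fun _ : n =>
      Metric.closedBall (0 : 𝕜) 1) :=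
    isCompact_univ_pi fun _ => isCompact_univ_pi fun _ => isCompact_closedBall _ _
  have hclosed : IsClosed (Matrix.unitaryGroup n 𝕜 : Set (Matrix n n 𝕜)) := isClosed_unitary
  exact hbox.of_isClosed_subset hclosed fun U hU i _ j _ => by
    simpa using entry_norm_bound_of_unitary hU i j

/-- Homomorphisms from a directed family of subgroups covering `G` into a compact Hausdorff
group have a limit homomorphism on `G`: it satisfies every pointwise closed condition that
all of them satisfy. -/
theorem exists_monoidHom_mem_of_isClosed {G H I : Type*} [Group G] [Group H]
    [TopologicalSpace H] [ContinuousMul H] [CompactSpace H] [T2Space H]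
    [Preorder I] [IsDirectedOrder I] [Nonempty I] {Gs : I → Subgroup G} (hmono : Monotone Gs)
    (hcover : ∀ g : G, ∃ i, g ∈ Gs i) (ρ : ∀ i, Gs i →* H) :
    ∃ σ : G →* H, ∀ (x : G) (s : Set H), IsClosed s →
      (∀ i (hx : x ∈ Gs i), ρ i ⟨x, hx⟩ ∈ s) → σ x ∈ s := by
  classical
  let u : Ultrafilter I := Ultrafilter.of atTop
  have hu : (u : Filter I) ≤ atTop := Ultrafilter.of_le atTop
  let φ : G → I → H := fun x i => if hx : x ∈ Gs i then ρ i ⟨x, hx⟩ else 1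
  have hmem (x : G) : ∀ᶠ i in (u : Filter I), x ∈ Gs i := by
    obtain ⟨i, hi⟩ := hcover x
    exact hu ((eventually_ge_atTop i).mono fun j hij => hmono hij hi)
  have hlim (x : G) : ∃ a, Tendsto (φ x) u (𝓝 a) := ⟨_, (u.map (φ x)).le_nhds_lim⟩
  choose σ hσ using hlim
  refine ⟨MonoidHom.mk' σ fun x y => ?_, fun x s hs h => ?_⟩
  · refine tendsto_nhds_unique (hσ (x * y)) (((hσ x).mul (hσ y)).congr' ?_)
    filter_upwards [hmem x, hmem y] with i hx hy
    simp only [φ, dif_pos hx, dif_pos hy, dif_pos (mul_mem hx hy), ← map_mul]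
    rfl
  · refine hs.mem_of_tendsto (hσ x) ?_
    filter_upwards [hmem x] with i hx
    simpa only [φ, dif_pos hx] using h i hx


/-- Quantitative inductivity of finite-dimensional uniform
stability: if every subgroup `G i` in a monotone family covering `G` is
uniformly `(U(d), N)`-stable with modulus function `F`, then so is `G`,
with the same modulus `F`. -/
theorem finite_dim_inductivity (G : Type*) [Group G]
    (I : Type*) [LinearOrder I] [Nonempty I]
    (Gs : I → Subgroup G) (hmono : Monotone Gs) (hcover : ∀ g : G, ∃ i, g ∈ Gs i)
    (d : ℕ) (hd : 1 ≤ d)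
    (N : Matrix (Fin d) (Fin d) ℂ → ℝ)
    (hN0 : ∀ M, N M = 0 ↔ M = 0)
    (hNadd : ∀ M M', N (M + M') ≤ N M + N M')
    (hNsmul : ∀ (z : ℂ) (M), N (z • M) = ‖z‖ * N M)
    (F : ℝ → ℝ) (hF : ∀ ε : ℝ, 0 ≤ ε → 0 ≤ F ε)
    (hstab : ∀ (i : I) (ε : ℝ), 0 ≤ ε →
      ∀ f : Gs i → Matrix.unitaryGroup (Fin d) ℂ, f 1 = 1 →
      (∀ x y : Gs i, N ((f (x * y) : Matrix (Fin d) (Fin d) ℂ) -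
        (f x : Matrix (Fin d) (Fin d) ℂ) * (f y : Matrix (Fin d) (Fin d) ℂ)) ≤ ε) →
      ∃ ρ : Gs i →* Matrix.unitaryGroup (Fin d) ℂ,
        ∀ x : Gs i, N ((f x : Matrix (Fin d) (Fin d) ℂ) -
          (ρ x : Matrix (Fin d) (Fin d) ℂ)) ≤ F ε) :
    ∀ (ε : ℝ), 0 ≤ ε →
      ∀ f : G → Matrix.unitaryGroup (Fin d) ℂ, f 1 = 1 →
      (∀ x y : G, N ((f (x * y) : Matrix (Fin d) (Fin d) ℂ) -
        (f x : Matrix (Fin d) (Fin d) ℂ) * (f y : Matrix (Fin d) (Fin d) ℂ)) ≤ ε) →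
      ∃ ρ : G →* Matrix.unitaryGroup (Fin d) ℂ,
        ∀ x : G, N ((f x : Matrix (Fin d) (Fin d) ℂ) -
          (ρ x : Matrix (Fin d) (Fin d) ℂ)) ≤ F ε := by
  intro ε hε f hf1 hf
  have hN : Continuous N :=
    (Seminorm.of (𝕜 := ℂ) (E := Fin d → Fin d → ℂ) N hNadd
      hNsmul).continuous_of_finiteDimensional_complex
  have := Matrix.compactSpace_unitaryGroup (Fin d) ℂ
  choose ρ hρ using fun i => hstab i ε hε (fun x => f x) hf1 fun x y => hf x y
  obtain ⟨σ, hσ⟩ := exists_monoidHom_mem_of_isClosed hmono hcover ρ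
  refine ⟨σ, fun x => hσ x {U | N ((f x : Matrix (Fin d) (Fin d) ℂ) - U) ≤ F ε} ?_
    fun i hx => hρ i ⟨x, hx⟩⟩
  exact isClosed_le (hN.comp (continuous_const.sub continuous_subtype_val)) continuous_const
end

section
/- Let ℋ be a complex Hilbert space and T an invertible bounded operator on ℋ, and let |T| = (T*T)^{1/2} denote the positive square root of T*T. Then |T| is invertible, the operator U = T·|T|⁻¹ is unitary, and ‖U − T‖ ≤ ‖1 − |T|‖. Moreover, if 0 ≤ a < 1 and (1−a)·1 ≤ T*T ≤ 1 in the operator order, then ‖U − T‖ ≤ a. -/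
section CStarAlgebra

variable {A : Type*} [CStarAlgebra A]

theorem mul_ringInverse_mem_unitary_of_mul_self_eq {t r : A} (ht : IsUnit t) (hr : IsUnit r)
    (hsa : IsSelfAdjoint r) (h : r * r = star t * t) : t * Ring.inverse r ∈ unitary A := by
  refine (ht.mul hr.ringInverse).mem_unitary_of_star_mul_self ?_
  rw [star_mul, ← Ring.inverse_star, hsa.star_eq]
  calc Ring.inverse r * star t * (t * Ring.inverse r)
      = Ring.inverse r * (star t * t) * Ring.inverse r := by simp only [mul_assoc]
    _ = (Ring.inverse r * r) * (r * Ring.inverse r) := by rw [← h]; simp only [mul_assoc]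
    _ = 1 := by rw [Ring.inverse_mul_cancel r hr, Ring.mul_inverse_cancel r hr, one_mul]

theorem norm_mul_ringInverse_sub_le {t r : A} (hr : IsUnit r)
    (hu : t * Ring.inverse r ∈ unitary A) : ‖t * Ring.inverse r - t‖ ≤ ‖1 - r‖ := by
  have hfactor : t * Ring.inverse r - t = t * Ring.inverse r * (1 - r) := by
    rw [mul_sub, mul_one, mul_assoc t, Ring.inverse_mul_cancel r hr, mul_one]
  rw [hfactor, CStarRing.norm_mem_unitary_mul _ hu]

variable [PartialOrder A] [StarOrderedRing A]

theorem norm_one_sub_le_of_le_mul_self {r : A} (hr : 0 ≤ r) {a : ℝ} (ha : 0 ≤ a)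
    (hlow : (1 - a) • (1 : A) ≤ r * r) (hup : r * r ≤ 1) : ‖1 - r‖ ≤ a := by
  have hr_one : r ≤ 1 := by
    simpa [CFC.sqrt_mul_self r hr] using CFC.sqrt_le_sqrt _ _ hup
  have hsq : r * r ≤ r := by
    have hs := CFC.sqrt_mul_sqrt_self r hr
    have hc := (CFC.sqrt_nonneg r).isSelfAdjoint.conjugate_nonneg (sub_nonneg.mpr hr_one)
    refine sub_nonneg.mp (hc.trans_eq ?_)
    generalize CFC.sqrt r = s at hs
    subst hs
    noncomm_ring
  rw [CStarAlgebra.norm_le_iff_le_algebraMap _ ha (sub_nonneg.mpr hr_one),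
    Algebra.algebraMap_eq_smul_one]
  have hle := hlow.trans hsq
  rw [sub_smul, one_smul] at hle
  exact sub_le_comm.mp hle

end CStarAlgebra

/-- Let `T` be an invertible bounded operator on a complex
Hilbert space and let `R = |T|` be the positive square root of `T*T` (i.e. `R`
is positive with `R · R = T*T`). Then `R` is invertible, `U = T · R⁻¹` is
unitary, and `‖U − T‖ ≤ ‖1 − R‖`. Moreover, if `0 ≤ a < 1` and
`(1 − a)·1 ≤ T*T ≤ 1` in the operator (Loewner) order — expressed via
positivity of the differences — then `‖U − T‖ ≤ a`. -/
theorem polar_unitary_close (ℋ : Type*)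
    [NormedAddCommGroup ℋ] [InnerProductSpace ℂ ℋ] [CompleteSpace ℋ]
    (T R : ℋ →L[ℂ] ℋ) (hT : IsUnit T)
    (hR : R.IsPositive) (hRsq : R * R = star T * T) :
    IsUnit R ∧
    (T * Ring.inverse R) ∈ unitary (ℋ →L[ℂ] ℋ) ∧
    ‖T * Ring.inverse R - T‖ ≤ ‖(1 : ℋ →L[ℂ] ℋ) - R‖ ∧
    ∀ a : ℝ, 0 ≤ a → a < 1 →
      (star T * T - (1 - a) • (1 : ℋ →L[ℂ] ℋ)).IsPositive →
      ((1 : ℋ →L[ℂ] ℋ) - star T * T).IsPositive →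
      ‖T * Ring.inverse R - T‖ ≤ a := by
  have hRsa : IsSelfAdjoint R := hR.isSelfAdjoint
  have hRu : IsUnit R :=
    ((Commute.refl R).isUnit_mul_iff.mp (hRsq ▸ hT.star.mul hT)).1
  have hU := mul_ringInverse_mem_unitary_of_mul_self_eq hT hRu hRsa hRsq
  have hnorm := norm_mul_ringInverse_sub_le hRu hU
  refine ⟨hRu, hU, hnorm, fun a ha _ hlow hup ↦ hnorm.trans ?_⟩
  rw [← hRsq] at hlow hup
  exact norm_one_sub_le_of_le_mul_self ((ContinuousLinearMap.nonneg_iff_isPositive R).mpr hR) ha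
    ((ContinuousLinearMap.le_def _ _).mpr hlow) ((ContinuousLinearMap.le_def _ _).mpr hup)
end
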